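/- Let u be C² on Ω ⊂ R² with Du(x) ≠ 0 at a point x, and let 1 < p < ∞. Then Δ_p u(x) = 0 if and only if u(x) = (2/p - 1)·med_{∂B_ε(x)} u + (2 - 2/p)·(average of u over ∂B_ε(x)) + o(ε²) as ε → 0. -/

import Mathlib

open MeasureTheory Real Filter Asymptotics Metric Set Topology

/-- Partial derivative ∂u/∂x_i. -/
noncomputable def pd {N : ℕ} (u : EuclideanSpace ℝ (Fin N) → ℝ) (i : Fin N)
    (x : EuclideanSpace ℝ (Fin N)) : ℝ :=
  fderiv ℝ u x (EuclideanSpace.single i 1)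

/-- Second partial derivative ∂²u/∂x_i∂x_j. -/
noncomputable def pd2 {N : ℕ} (u : EuclideanSpace ℝ (Fin N) → ℝ) (i j : Fin N)
    (x : EuclideanSpace ℝ (Fin N)) : ℝ :=
  pd (pd u j) i x

/-- The norm of the gradient |Du(x)|. -/
noncomputable def gradNorm {N : ℕ} (u : EuclideanSpace ℝ (Fin N) → ℝ)
    (x : EuclideanSpace ℝ (Fin N)) : ℝ :=
  Real.sqrt (∑ i, (pd u i x) ^ 2)

/-- The Laplacian Δu. -/
noncomputable def lap {N : ℕ} (u : EuclideanSpace ℝ (Fin N) → ℝ)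
    (x : EuclideanSpace ℝ (Fin N)) : ℝ :=
  ∑ i, pd2 u i i x

/-- The infinity-Laplacian Δ_∞ u = |Du|⁻² Σ ∂_i u ∂_j u ∂_ij u. -/
noncomputable def infLap {N : ℕ} (u : EuclideanSpace ℝ (Fin N) → ℝ)
    (x : EuclideanSpace ℝ (Fin N)) : ℝ :=
  (∑ i, ∑ j, pd u i x * pd u j x * pd2 u i j x) / (gradNorm u x) ^ 2

/-- The p-Laplacian Δ_p u = div(|Du|^{p-2} Du). -/
noncomputable def pLap {N : ℕ} (p : ℝ) (u : EuclideanSpace ℝ (Fin N) → ℝ)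
    (x : EuclideanSpace ℝ (Fin N)) : ℝ :=
  ∑ i, pd (fun y => gradNorm u y ^ (p - 2) * pd u i y) i x

/-- The 1-Laplacian Δ_1 u = |Du| div(Du/|Du|). -/
noncomputable def oneLap {N : ℕ} (u : EuclideanSpace ℝ (Fin N) → ℝ)
    (x : EuclideanSpace ℝ (Fin N)) : ℝ :=
  gradNorm u x * ∑ i, pd (fun y => pd u i y / gradNorm u y) i x

/-- The point x + ε(cos θ, sin θ) on the circle ∂B_ε(x). -/
noncomputable def circlePt (x : EuclideanSpace ℝ (Fin 2)) (ε θ : ℝ) :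
    EuclideanSpace ℝ (Fin 2) :=
  x + ε • (EuclideanSpace.single 0 (Real.cos θ) + EuclideanSpace.single 1 (Real.sin θ))

/-- The average of u over the circle ∂B_ε(x). -/
noncomputable def circleAvg (u : EuclideanSpace ℝ (Fin 2) → ℝ)
    (x : EuclideanSpace ℝ (Fin 2)) (ε : ℝ) : ℝ :=
  (2 * Real.pi)⁻¹ * ∫ θ in (0:ℝ)..(2 * Real.pi), u (circlePt x ε θ)

/-- m is a median of u over the circle ∂B_ε(x): the arc-length measures of the
sets where u ≥ m and u ≤ m coincide. -/
def IsCircleMedian (u : EuclideanSpace ℝ (Fin 2) → ℝ)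
    (x : EuclideanSpace ℝ (Fin 2)) (ε m : ℝ) : Prop :=
  volume {θ ∈ Set.Ico (0:ℝ) (2 * Real.pi) | m ≤ u (circlePt x ε θ)} =
  volume {θ ∈ Set.Ico (0:ℝ) (2 * Real.pi) | u (circlePt x ε θ) ≤ m}

/-- A median of a continuous `2π`-periodic function is a common lower bound of its values at some
pair of antipodal points. -/
theorem exists_median_le_antipodal {F : ℝ → ℝ} (hF : Continuous F)
    (hper : Function.Periodic F (2 * π)) {m : ℝ}
    (hm : volume {θ ∈ Set.Ico (0:ℝ) (2 * π) | m ≤ F θ} =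
      volume {θ ∈ Set.Ico (0:ℝ) (2 * π) | F θ ≤ m}) :
    ∃ θ, m ≤ F θ ∧ m ≤ F (θ + π) := by
  by_contra! hcon
  have hpi := Real.pi_pos
  obtain ⟨θ₀, hθ₀, hz⟩ : ∃ θ ∈ uIcc 0 π, F θ - F (θ + π) = 0 := by
    have hc : ContinuousOn (fun θ => F θ - F (θ + π)) (uIcc 0 π) := by fun_prop
    have h := intermediate_value_uIcc hc
    have h2 : F (π + π) = F 0 := by
      have := hper 0
      rwa [zero_add, two_mul] at this
    have h0 : (0:ℝ) ∈ uIcc (F 0 - F (0 + π)) (F π - F (π + π)) := by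
      rw [h2, zero_add, mem_uIcc]
      rcases le_total (F 0) (F π) with h | h
      · left; constructor <;> linarith
      · right; constructor <;> linarith
    exact h h0
  rw [uIcc_of_le hpi.le] at hθ₀
  have hlt : F θ₀ < m := by
    by_contra! h
    have := hcon θ₀ h
    linarith
  have hopen : IsOpen {θ | F θ < m ∧ F (θ + π) < m} :=
    (isOpen_lt hF continuous_const).inter
      (isOpen_lt (by fun_prop : Continuous fun θ => F (θ + π)) continuous_const)
  have hUpos : 0 < volume ({θ | F θ < m ∧ F (θ + π) < m} ∩ Ioo 0 (2 * π)) := by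
    refine (hopen.inter isOpen_Ioo).measure_pos volume ?_
    have hcl : θ₀ ∈ closure (Ioo 0 (2 * π)) := by
      rw [closure_Ioo (by positivity)]
      exact ⟨hθ₀.1, by linarith [hθ₀.2]⟩
    exact mem_closure_iff.1 hcl _ hopen ⟨hlt, by linarith⟩
  have hshift : volume {θ ∈ Set.Ico (0:ℝ) (2 * π) | m ≤ F (θ + π)} =
      volume {θ ∈ Set.Ico (0:ℝ) (2 * π) | m ≤ F θ} := by
    have hS : MeasurableSet {θ | m ≤ F θ} := measurableSet_le measurable_const hF.measurable
    have hS' : MeasurableSet {θ | m ≤ F (θ + π)} :=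
      measurableSet_le measurable_const (by fun_prop)
    have key : ∀ S : Set ℝ, MeasurableSet S →
        volume (Ico 0 (2 * π) ∩ S) = volume (Ico 0 π ∩ S) + volume (Ico π (2 * π) ∩ S) := by
      intro S hS
      rw [← Ico_union_Ico_eq_Ico hpi.le (by linarith : π ≤ 2 * π), union_inter_distrib_right,
        measure_union _ (measurableSet_Ico.inter hS)]
      exact (Ico_disjoint_Ico_same).mono inter_subset_left inter_subset_left
    change volume (Ico 0 (2 * π) ∩ {θ | m ≤ F (θ + π)}) = volume (Ico 0 (2 * π) ∩ {θ | m ≤ F θ})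
    rw [key _ hS, key _ hS', add_comm]
    congr 1
    · rw [← measure_preimage_add_right volume (-π) (Ico 0 π ∩ {θ | m ≤ F θ})]
      congr 1
      ext θ
      have : F (θ + π) = F (θ + -π) := by
        rw [← hper (θ + -π)]; ring_nf
      simp only [mem_inter_iff, mem_Ico, mem_ofPred_eq, mem_preimage, this]
      constructor <;> rintro ⟨⟨h1, h2⟩, h3⟩ <;> exact ⟨⟨by linarith, by linarith⟩, h3⟩
    · rw [← measure_preimage_add_right volume π (Ico π (2 * π) ∩ {θ | m ≤ F θ})]
      congr 1
      ext θ
      simp only [mem_inter_iff, mem_Ico, mem_ofPred_eq, mem_preimage]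
      constructor <;> rintro ⟨⟨h1, h2⟩, h3⟩ <;> exact ⟨⟨by linarith, by linarith⟩, h3⟩
  have hdisj : Disjoint ({θ | F θ < m ∧ F (θ + π) < m} ∩ Ioo 0 (2 * π))
      {θ ∈ Set.Ico (0:ℝ) (2 * π) | m ≤ F (θ + π)} := by
    rw [Set.disjoint_left]
    rintro θ ⟨⟨_, h⟩, _⟩ ⟨_, h'⟩
    exact absurd h' (not_le.2 h)
  have hsub : ({θ | F θ < m ∧ F (θ + π) < m} ∩ Ioo 0 (2 * π)) ∪
      {θ ∈ Set.Ico (0:ℝ) (2 * π) | m ≤ F (θ + π)} ⊆ {θ ∈ Set.Ico (0:ℝ) (2 * π) | F θ ≤ m} := by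
    rintro θ (⟨⟨h, _⟩, h2⟩ | ⟨h1, h2⟩)
    · exact ⟨Ioo_subset_Ico_self h2, h.le⟩
    · refine ⟨h1, ?_⟩
      by_contra! h
      exact absurd h2 (not_le.2 (hcon θ h.le))
  have hle := measure_mono (μ := volume) hsub
  rw [measure_union' hdisj (hopen.inter isOpen_Ioo).measurableSet, hshift, ← hm] at hle
  have hfin : volume {θ ∈ Set.Ico (0:ℝ) (2 * π) | m ≤ F θ} ≠ ⊤ :=
    ((measure_mono (sep_subset _ _)).trans_lt measure_Ico_lt_top).ne
  have := ENNReal.lt_add_right hfin hUpos.ne'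
  rw [add_comm] at this
  exact absurd hle (not_le.2 this)

/-- A median of a continuous `2π`-periodic function is a common upper bound of its values at some
pair of antipodal points. -/
theorem exists_antipodal_le_median {F : ℝ → ℝ} (hF : Continuous F)
    (hper : Function.Periodic F (2 * π)) {m : ℝ}
    (hm : volume {θ ∈ Set.Ico (0:ℝ) (2 * π) | m ≤ F θ} =
      volume {θ ∈ Set.Ico (0:ℝ) (2 * π) | F θ ≤ m}) :
    ∃ θ, F θ ≤ m ∧ F (θ + π) ≤ m := by
  obtain ⟨θ, h⟩ := exists_median_le_antipodal (F := fun θ => -F θ) (m := -m) hF.neg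
    (fun θ => congrArg Neg.neg (hper θ)) (by simpa using hm.symm)
  exact ⟨θ, by simpa using h⟩

/-- On the unit circle, the quadratic form differs from its value at the zeros of a nonzero linear
form by at most a multiple of that linear form. -/
theorem exists_abs_quadratic_sub_le {a b : ℝ} (hab : 0 < a ^ 2 + b ^ 2) (A B D : ℝ) :
    ∃ C > 0, ∀ c s : ℝ, c ^ 2 + s ^ 2 = 1 →
      |(A * c ^ 2 + 2 * B * c * s + D * s ^ 2)
        - (A * b ^ 2 - 2 * B * a * b + D * a ^ 2) / (a ^ 2 + b ^ 2)| ≤ C * |a * c + b * s| := by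
  set g := a ^ 2 + b ^ 2 with hg
  set X := A * a ^ 2 + 2 * B * a * b + D * b ^ 2 - (A * b ^ 2 - 2 * B * a * b + D * a ^ 2) with hX
  set Y := 2 * (-A * a * b + B * (a ^ 2 - b ^ 2) + D * a * b) with hY
  refine ⟨((|a| + |b|) * (|X| + |Y|) + 1) / g ^ 2, by positivity, fun c s hcs => ?_⟩
  have hc : |c| ≤ 1 := abs_le_one_iff_mul_self_le_one.2 (by nlinarith)
  have hs : |s| ≤ 1 := abs_le_one_iff_mul_self_le_one.2 (by nlinarith)
  have h1 : ∀ y z : ℝ, |y * c + z * s| ≤ |y| + |z| := fun y z => by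
    refine (abs_add_le _ _).trans ?_
    rw [abs_mul, abs_mul]
    nlinarith [abs_nonneg y, abs_nonneg z]
  have hid : (A * c ^ 2 + 2 * B * c * s + D * s ^ 2)
        - (A * b ^ 2 - 2 * B * a * b + D * a ^ 2) / g =
      (a * c + b * s) * ((a * c + b * s) * X + (-b * c + a * s) * Y) / g ^ 2 := by
    field_simp
    rw [hX, hY, hg]
    linear_combination ((a ^ 2 + b ^ 2) * (A * b ^ 2 - 2 * B * a * b + D * a ^ 2)) * hcs
  rw [hid, abs_div, abs_mul, abs_of_pos (by positivity : 0 < g ^ 2), div_mul_eq_mul_div, mul_comm]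
  gcongr
  refine (abs_add_le _ _).trans ?_
  rw [abs_mul, abs_mul]
  have h2 := h1 a b
  have h3 := h1 (-b) a
  rw [abs_neg] at h3
  nlinarith [abs_nonneg X, abs_nonneg Y]

/-- Asymptotics of the medians of functions on the circle having a uniform second order
expansion with nonzero linear part. -/
theorem median_isLittleO {F : ℝ → ℝ → ℝ} {a b A B D u₀ : ℝ} (hab : 0 < a ^ 2 + b ^ 2)
    (hF : ∀ᶠ ε in 𝓝[>] (0:ℝ), Continuous (F ε)) (hper : ∀ ε, Function.Periodic (F ε) (2 * π))
    (hT : ∀ η > 0, ∀ᶠ ε in 𝓝[>] (0:ℝ), ∀ θ, |F ε θ - (u₀ + ε * (a * cos θ + b * sin θ) +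
      ε ^ 2 / 2 * (A * cos θ ^ 2 + 2 * B * cos θ * sin θ + D * sin θ ^ 2))| ≤ η * ε ^ 2)
    {m : ℝ → ℝ}
    (hm : ∀ᶠ ε in 𝓝[>] (0:ℝ), volume {θ ∈ Set.Ico (0:ℝ) (2 * π) | m ε ≤ F ε θ} =
      volume {θ ∈ Set.Ico (0:ℝ) (2 * π) | F ε θ ≤ m ε}) :
    (fun ε => m ε - (u₀ + ε ^ 2 *
      ((A * b ^ 2 - 2 * B * a * b + D * a ^ 2) / (a ^ 2 + b ^ 2) / 2)))
      =o[𝓝[>] (0:ℝ)] fun ε => ε ^ 2 := by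
  obtain ⟨C, hC, hQ⟩ := exists_abs_quadratic_sub_le hab A B D
  set L := (A * b ^ 2 - 2 * B * a * b + D * a ^ 2) / (a ^ 2 + b ^ 2)
  rw [isLittleO_iff]
  intro η hη
  have hsmall : ∀ᶠ ε in 𝓝[>] (0:ℝ), ε < 1 / C :=
    mem_nhdsWithin_of_mem_nhds (Iio_mem_nhds (by positivity))
  filter_upwards [hF, hT η hη, hm, hsmall, self_mem_nhdsWithin] with ε hFε hTε hmε hεC hε
  have hε : 0 < ε := hε
  rw [lt_div_iff₀ hC] at hεC
  have key : ∀ t : ℝ, (ε * C) * (ε * |t|) ≤ ε * |t| := fun t =>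
    mul_le_of_le_one_left (by positivity) hεC.le
  rw [Real.norm_eq_abs, Real.norm_eq_abs, abs_of_nonneg (sq_nonneg ε), abs_le]
  constructor
  · obtain ⟨θ, h1, h2⟩ := exists_antipodal_le_median hFε (hper ε) hmε
    have t1 := abs_le.1 (hTε θ)
    have t2 := abs_le.1 (hTε (θ + π))
    rw [cos_add_pi, sin_add_pi] at t2
    have hq := abs_le.1 (hQ (cos θ) (sin θ) (cos_sq_add_sin_sq θ))
    have hk := key (a * cos θ + b * sin θ)
    have hq' := mul_le_mul_of_nonneg_left hq.1 (sq_nonneg ε)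
    rcases abs_cases (a * cos θ + b * sin θ) with ⟨h, _⟩ | ⟨h, _⟩ <;> rw [h] at hk hq' <;>
      nlinarith
  · obtain ⟨θ, h1, h2⟩ := exists_median_le_antipodal hFε (hper ε) hmε
    have t1 := abs_le.1 (hTε θ)
    have t2 := abs_le.1 (hTε (θ + π))
    rw [cos_add_pi, sin_add_pi] at t2
    have hq := abs_le.1 (hQ (cos θ) (sin θ) (cos_sq_add_sin_sq θ))
    have hk := key (a * cos θ + b * sin θ)
    have hq' := mul_le_mul_of_nonneg_left hq.2 (sq_nonneg ε)
    rcases abs_cases (a * cos θ + b * sin θ) with ⟨h, _⟩ | ⟨h, _⟩ <;> rw [h] at hk hq' <;>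
      nlinarith

/-- Asymptotics of the means of functions on the circle having a uniform second order
expansion. -/
theorem mean_isLittleO {F : ℝ → ℝ → ℝ} {a b A B D u₀ : ℝ}
    (hF : ∀ᶠ ε in 𝓝[>] (0:ℝ), Continuous (F ε))
    (hT : ∀ η > 0, ∀ᶠ ε in 𝓝[>] (0:ℝ), ∀ θ, |F ε θ - (u₀ + ε * (a * cos θ + b * sin θ) +
      ε ^ 2 / 2 * (A * cos θ ^ 2 + 2 * B * cos θ * sin θ + D * sin θ ^ 2))| ≤ η * ε ^ 2) :
    (fun ε => (2 * π)⁻¹ * (∫ θ in (0:ℝ)..(2 * π), F ε θ) - (u₀ + ε ^ 2 * ((A + D) / 4)))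
      =o[𝓝[>] (0:ℝ)] fun ε => ε ^ 2 := by
  have hpi := Real.pi_pos
  rw [isLittleO_iff]
  intro η hη
  filter_upwards [hF, hT η hη] with ε hFε hTε
  have hP : ∫ θ in (0:ℝ)..(2 * π), (u₀ + ε * (a * cos θ + b * sin θ) +
      ε ^ 2 / 2 * (A * cos θ ^ 2 + 2 * B * cos θ * sin θ + D * sin θ ^ 2)) =
      (2 * π) * (u₀ + ε ^ 2 * ((A + D) / 4)) := by
    have hd : ∀ θ ∈ uIcc 0 (2 * π), HasDerivAt (fun θ : ℝ => u₀ * θ +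
        ε * (a * sin θ - b * cos θ) + ε ^ 2 / 2 * (A * ((θ + sin θ * cos θ) / 2) +
          B * sin θ ^ 2 + D * ((θ - sin θ * cos θ) / 2)))
        (u₀ + ε * (a * cos θ + b * sin θ) +
          ε ^ 2 / 2 * (A * cos θ ^ 2 + 2 * B * cos θ * sin θ + D * sin θ ^ 2)) θ := by
      intro θ _
      have hs := hasDerivAt_sin θ
      have hc := hasDerivAt_cos θ
      have hi := hasDerivAt_id θ
      have := ((hi.const_mul u₀).add (((hs.const_mul a).sub (hc.const_mul b)).const_mul ε)).add
        (((((hi.add (hs.mul hc)).div_const 2).const_mul A).add ((hs.pow 2).const_mul B)).add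
          (((hi.sub (hs.mul hc)).div_const 2).const_mul D) |>.const_mul (ε ^ 2 / 2))
      refine this.congr_deriv ?_
      have h1 := sin_sq_add_cos_sq θ
      simp only [Nat.cast_ofNat]
      linear_combination (-(ε ^ 2 / 4 * A) - ε ^ 2 / 4 * D) * h1
    rw [intervalIntegral.integral_eq_sub_of_hasDerivAt hd
      (Continuous.intervalIntegrable (by fun_prop) _ _)]
    simp
    ring
  simp_rw [← Real.norm_eq_abs] at hTε
  have hb := intervalIntegral.norm_integral_le_of_norm_le_const (a := 0) (b := 2 * π)
    (fun θ _ => hTε θ)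
  rw [intervalIntegral.integral_sub (hFε.intervalIntegrable _ _)
    (Continuous.intervalIntegrable (by fun_prop) _ _), hP, sub_zero,
    abs_of_pos (by positivity)] at hb
  have : (2 * π)⁻¹ * (∫ θ in (0:ℝ)..(2 * π), F ε θ) - (u₀ + ε ^ 2 * ((A + D) / 4)) =
      ((∫ θ in (0:ℝ)..(2 * π), F ε θ) - (2 * π) * (u₀ + ε ^ 2 * ((A + D) / 4))) / (2 * π) := by
    field_simp
  rw [this, norm_div, Real.norm_of_nonneg (by positivity : 0 ≤ 2 * π),
    Real.norm_of_nonneg (sq_nonneg ε), div_le_iff₀ (by positivity)]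
  exact hb

/-- Second order Taylor expansion with little-o remainder. -/
theorem ContDiffAt.taylor_two_isLittleO {E : Type*} [NormedAddCommGroup E] [NormedSpace ℝ E]
    {u : E → ℝ} {x : E} (hu : ContDiffAt ℝ 2 u x) :
    (fun h => u (x + h) - (u x + fderiv ℝ u x h + 1 / 2 * fderiv ℝ (fderiv ℝ u) x h h))
      =o[𝓝 0] fun h => ‖h‖ ^ 2 := by
  set T := fderiv ℝ (fderiv ℝ u) x
  have hsymm : ∀ v w, T v w = T w v := by
    intro v w
    exact (hu.isSymmSndFDerivAt (by simp)) v w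
  have hd : DifferentiableAt ℝ (fderiv ℝ u) x :=
    (hu.fderiv_right (m := 1) (by norm_num)).differentiableAt (by norm_num)
  have hdiff : ∀ᶠ y in 𝓝 x, DifferentiableAt ℝ u y := by
    filter_upwards [hu.eventually (by simp)] with y hy
    exact hy.differentiableAt (by norm_num)
  have ho := hd.hasFDerivAt.isLittleO
  rw [isLittleO_iff]
  intro η hη
  rw [isLittleO_iff] at ho
  obtain ⟨r, hr, hball⟩ := Metric.eventually_nhds_iff_ball.1 ((ho hη).and hdiff)
  filter_upwards [Metric.ball_mem_nhds (0:E) hr] with h hh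
  have hhr : ‖h‖ < r := by simpa using hh
  have hder : ∀ k ∈ closedBall (0:E) ‖h‖, HasFDerivWithinAt
      (fun k => u (x + k) - (u x + fderiv ℝ u x k + 1 / 2 * T k k))
      (fderiv ℝ u (x + k) - (fderiv ℝ u x + T k)) (closedBall (0:E) ‖h‖) k := by
    intro k hk
    have hk' : x + k ∈ ball x r := by
      simp at hk ⊢; linarith
    have h1 : HasFDerivAt (fun k => u (x + k)) (fderiv ℝ u (x + k)) k := by
      have h2 := (hball _ hk').2.hasFDerivAt
      exact (h2.comp k ((hasFDerivAt_id k).const_add x)).congr_fderiv (by ext; simp)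
    have h3 : HasFDerivAt (fun k => T k k) (T k + T.flip k) k := by
      exact (T.hasFDerivAt.clm_apply (hasFDerivAt_id k)).congr_fderiv (by ext; simp)
    have h4 := h1.sub ((((fderiv ℝ u x).hasFDerivAt (x := k)).const_add (u x)).add
      (h3.const_mul (1 / 2)))
    refine (h4.congr_fderiv ?_).hasFDerivWithinAt
    ext v
    simp [hsymm v k]
    ring
  have hbd : ∀ k ∈ closedBall (0:E) ‖h‖,
      ‖fderiv ℝ u (x + k) - (fderiv ℝ u x + T k)‖ ≤ η * ‖h‖ := by
    intro k hk
    have hk2 : ‖k‖ ≤ ‖h‖ := by simpa using hk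
    have hk' : x + k ∈ ball x r := by
      simp; linarith
    have := (hball _ hk').1
    simp only [add_sub_cancel_left] at this
    rw [← sub_sub]
    exact this.trans (by gcongr)
  have := (convex_closedBall (0:E) ‖h‖).norm_image_sub_le_of_norm_hasFDerivWithin_le hder hbd
    (by simp : (0:E) ∈ _) (by simp : h ∈ _)
  simpa [pow_two, mul_assoc] using this

/-- The first partial derivatives of a `C²` function are differentiable. -/
theorem hasFDerivAt_pd {N : ℕ} {u : EuclideanSpace ℝ (Fin N) → ℝ} {x : EuclideanSpace ℝ (Fin N)}
    (hu : ContDiffAt ℝ 2 u x) (i : Fin N) :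
    HasFDerivAt (pd u i) ((fderiv ℝ (fderiv ℝ u) x).flip (EuclideanSpace.single i 1)) x := by
  have hd : DifferentiableAt ℝ (fderiv ℝ u) x :=
    (hu.fderiv_right (m := 1) (by norm_num)).differentiableAt (by norm_num)
  exact (hd.hasFDerivAt.clm_apply
    (hasFDerivAt_const (EuclideanSpace.single i (1:ℝ)) x)).congr_fderiv (by ext; simp)

theorem pd2_eq_fderiv_fderiv {N : ℕ} {u : EuclideanSpace ℝ (Fin N) → ℝ}
    {x : EuclideanSpace ℝ (Fin N)} (hu : ContDiffAt ℝ 2 u x) (i j : Fin N) :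
    pd2 u i j x = fderiv ℝ (fderiv ℝ u) x (EuclideanSpace.single i 1)
      (EuclideanSpace.single j 1) := by
  rw [pd2, pd, (hasFDerivAt_pd hu j).fderiv, ContinuousLinearMap.flip_apply]

/-- Equality of mixed partial derivatives. -/
theorem pd2_comm {N : ℕ} {u : EuclideanSpace ℝ (Fin N) → ℝ} {x : EuclideanSpace ℝ (Fin N)}
    (hu : ContDiffAt ℝ 2 u x) (i j : Fin N) : pd2 u i j x = pd2 u j i x := by
  rw [pd2_eq_fderiv_fderiv hu, pd2_eq_fderiv_fderiv hu]
  exact (hu.isSymmSndFDerivAt (by simp)) _ _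

theorem gradNorm_sq_fin_two (u : EuclideanSpace ℝ (Fin 2) → ℝ) (x : EuclideanSpace ℝ (Fin 2)) :
    gradNorm u x ^ 2 = pd u 0 x ^ 2 + pd u 1 x ^ 2 := by
  rw [gradNorm, Real.sq_sqrt (Finset.sum_nonneg fun _ _ => sq_nonneg _), Fin.sum_univ_two]

/-- The planar `p`-Laplacian in nondivergence form. -/
theorem pLap_fin_two_eq {u : EuclideanSpace ℝ (Fin 2) → ℝ} {x : EuclideanSpace ℝ (Fin 2)}
    (hu : ContDiffAt ℝ 2 u x) (hg : 0 < gradNorm u x) (p : ℝ) :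
    pLap p u x = gradNorm u x ^ (p - 2) / gradNorm u x ^ 2 *
      (gradNorm u x ^ 2 * (pd2 u 0 0 x + pd2 u 1 1 x) + (p - 2) * (pd u 0 x ^ 2 * pd2 u 0 0 x +
        2 * pd u 0 x * pd u 1 x * pd2 u 0 1 x + pd u 1 x ^ 2 * pd2 u 1 1 x)) := by
  have hp0 := hasFDerivAt_pd hu 0
  have hp1 := hasFDerivAt_pd hu 1
  have hs : gradNorm u = fun y => Real.sqrt (pd u 0 y ^ 2 + pd u 1 y ^ 2) := by
    ext y
    rw [gradNorm, Fin.sum_univ_two]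
  have hpos : pd u 0 x ^ 2 + pd u 1 x ^ 2 ≠ 0 := by
    rw [← gradNorm_sq_fin_two]; positivity
  have hgd : HasFDerivAt (fun y => √(pd u 0 y ^ 2 + pd u 1 y ^ 2)) _ x :=
    ((hp0.pow 2).fun_add (hp1.pow 2)).sqrt hpos
  rw [← hs] at hgd
  have hgx : √(pd u 0 x ^ 2 + pd u 1 x ^ 2) = gradNorm u x := by rw [hs]
  have hw := hgd.rpow_const (p := p - 2) (Or.inl hg.ne')
  have hrp : gradNorm u x ^ (p - 2) = gradNorm u x ^ (p - 2 - 1) * gradNorm u x := by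
    rw [← Real.rpow_add_one hg.ne', sub_add_cancel]
  have hcomm := pd2_comm hu 1 0
  rw [pLap, Fin.sum_univ_two, pd, pd, (hw.fun_mul hp0).fderiv, (hw.fun_mul hp1).fderiv, hrp]
  simp [hgx, ← pd2_eq_fderiv_fderiv hu, hcomm]
  field_simp
  ring

/-- The uniform second order expansion of a `C²` function on small circles. -/
theorem circlePt_taylor {u : EuclideanSpace ℝ (Fin 2) → ℝ} {x : EuclideanSpace ℝ (Fin 2)}
    (hu : ContDiffAt ℝ 2 u x) {η : ℝ} (hη : 0 < η) :
    ∀ᶠ ε in 𝓝[>] (0:ℝ), ∀ θ, |u (circlePt x ε θ) -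
      (u x + ε * (pd u 0 x * cos θ + pd u 1 x * sin θ) +
      ε ^ 2 / 2 * (pd2 u 0 0 x * cos θ ^ 2 + 2 * pd2 u 0 1 x * cos θ * sin θ +
        pd2 u 1 1 x * sin θ ^ 2))| ≤ η * ε ^ 2 := by
  have ho := hu.taylor_two_isLittleO
  rw [isLittleO_iff] at ho
  obtain ⟨r, hr, hball⟩ := Metric.eventually_nhds_iff_ball.1 (ho hη)
  filter_upwards [Ioo_mem_nhdsGT hr] with ε hε θ
  set v : EuclideanSpace ℝ (Fin 2) :=
    cos θ • EuclideanSpace.single 0 1 + sin θ • EuclideanSpace.single 1 1 with hv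
  have hcv : circlePt x ε θ = x + ε • v := by
    ext i
    simp [circlePt, hv]
  have hvn : ‖v‖ = 1 := by
    rw [EuclideanSpace.norm_eq, Fin.sum_univ_two]
    simp [hv]
  have hn : ‖ε • v‖ = ε := by
    rw [norm_smul, hvn, mul_one, Real.norm_of_nonneg hε.1.le]
  have h := hball (ε • v) (by rw [mem_ball_zero_iff, hn]; exact hε.2)
  rw [hn, Real.norm_of_nonneg (sq_nonneg ε), Real.norm_eq_abs, ← hcv] at h
  have hcomm := pd2_comm hu 1 0
  rw [pd2_eq_fderiv_fderiv hu, pd2_eq_fderiv_fderiv hu] at hcomm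
  convert h using 3
  simp only [pd2_eq_fderiv_fderiv hu, pd, hv, map_smul, map_add, add_apply,
    smul_apply, smul_eq_mul, hcomm]
  ring

theorem continuous_circlePt (x : EuclideanSpace ℝ (Fin 2)) (ε : ℝ) :
    Continuous (circlePt x ε) := by
  have h : circlePt x ε = fun θ => x + ε • (cos θ • EuclideanSpace.single 0 (1:ℝ) +
      sin θ • EuclideanSpace.single 1 (1:ℝ)) := by
    ext θ i
    simp [circlePt]
  rw [h]
  fun_prop

theorem dist_circlePt (x : EuclideanSpace ℝ (Fin 2)) (ε θ : ℝ) :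
    dist (circlePt x ε θ) x = |ε| := by
  rw [circlePt, dist_self_add_left, norm_smul, EuclideanSpace.norm_eq, Fin.sum_univ_two]
  simp

/-- median/mean asymptotic characterization of Δ_p u(x) = 0. -/
theorem pLap_zero_iff_median_mean (Ω : Set (EuclideanSpace ℝ (Fin 2))) (hΩ : IsOpen Ω)
    (u : EuclideanSpace ℝ (Fin 2) → ℝ) (hu : ContDiffOn ℝ 2 u Ω)
    (x : EuclideanSpace ℝ (Fin 2)) (hx : x ∈ Ω) (hD : fderiv ℝ u x ≠ 0)
    (p : ℝ) (hp : 1 < p) (m : ℝ → ℝ)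
    (hm : ∀ᶠ ε in 𝓝[>] (0:ℝ), IsCircleMedian u x ε (m ε)) :
    pLap p u x = 0 ↔
      (fun ε : ℝ => u x - ((2 / p - 1) * m ε + (2 - 2 / p) * circleAvg u x ε))
        =o[𝓝[>] (0:ℝ)] fun ε => ε ^ 2 := by
  have hux : ContDiffAt ℝ 2 u x := hu.contDiffAt (hΩ.mem_nhds hx)
  have hg : 0 < gradNorm u x := by
    refine (Real.sqrt_nonneg _).lt_of_ne' fun h => hD ?_
    have h2 := gradNorm_sq_fin_two u x
    rw [gradNorm, h] at h2
    have h0 : pd u 0 x = 0 := by nlinarith [sq_nonneg (pd u 0 x), sq_nonneg (pd u 1 x)]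
    have h1 : pd u 1 x = 0 := by nlinarith [sq_nonneg (pd u 0 x), sq_nonneg (pd u 1 x)]
    ext v
    have hv : v = v 0 • EuclideanSpace.single 0 (1:ℝ) + v 1 • EuclideanSpace.single 1 (1:ℝ) := by
      ext i
      fin_cases i <;> simp
    rw [hv, map_add, map_smul, map_smul]
    change v 0 • pd u 0 x + v 1 • pd u 1 x = 0
    simp [h0, h1]
  have hg2 := gradNorm_sq_fin_two u x
  have hab : 0 < pd u 0 x ^ 2 + pd u 1 x ^ 2 := hg2 ▸ pow_pos hg 2
  have hcont : ∀ᶠ ε in 𝓝[>] (0:ℝ), Continuous fun θ => u (circlePt x ε θ) := by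
    obtain ⟨r, hr, hball⟩ := Metric.isOpen_iff.1 hΩ x hx
    filter_upwards [Ioo_mem_nhdsGT hr] with ε hε
    refine hu.continuousOn.comp_continuous (continuous_circlePt x ε) fun θ => hball ?_
    rw [mem_ball, dist_circlePt, abs_of_pos hε.1]
    exact hε.2
  have hper : ∀ ε, Function.Periodic (fun θ => u (circlePt x ε θ)) (2 * π) := fun ε θ => by
    simp only [circlePt, cos_add_two_pi, sin_add_two_pi]
  have hmed := median_isLittleO hab hcont hper (fun η hη => circlePt_taylor hux hη) hm
  have hmean := mean_isLittleO hcont (fun η hη => circlePt_taylor hux hη)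
  have hsum := (hmed.const_mul_left (2 / p - 1)).add (hmean.const_mul_left (2 - 2 / p))
  rw [pLap_fin_two_eq hux hg]
  set K := gradNorm u x ^ 2 * (pd2 u 0 0 x + pd2 u 1 1 x) + (p - 2) * (pd u 0 x ^ 2 * pd2 u 0 0 x +
    2 * pd u 0 x * pd u 1 x * pd2 u 0 1 x + pd u 1 x ^ 2 * pd2 u 1 1 x) with hK
  have hp0 : 0 < p := by linarith
  have hdiff : (fun ε : ℝ => u x - ((2 / p - 1) * m ε + (2 - 2 / p) * circleAvg u x ε) -
      -(K / (2 * p * gradNorm u x ^ 2)) * ε ^ 2) =o[𝓝[>] (0:ℝ)] fun ε => ε ^ 2 := by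
    refine hsum.neg_left.congr_left fun ε => ?_
    rw [circleAvg, hK, hg2]
    field_simp
    ring
  have hK0 : gradNorm u x ^ (p - 2) / gradNorm u x ^ 2 * K = 0 ↔ K = 0 := by
    have : gradNorm u x ^ (p - 2) / gradNorm u x ^ 2 ≠ 0 :=
      (div_pos (Real.rpow_pos_of_pos hg _) (pow_pos hg 2)).ne'
    simp [this]
  rw [hK0]
  constructor
  · intro h
    simpa [h] using hdiff
  · intro h
    have h2 := h.sub hdiff
    simp only [sub_sub_cancel] at h2
    by_contra hne
    have hc : -(K / (2 * p * gradNorm u x ^ 2)) ≠ 0 :=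
      neg_ne_zero.2 (div_ne_zero hne (by positivity))
    have h3 := (isLittleO_const_mul_left_iff hc).1 h2
    have hfr : ∃ᶠ ε in 𝓝[>] (0:ℝ), ε ^ 2 ≠ 0 := by
      refine Eventually.frequently ?_
      filter_upwards [self_mem_nhdsWithin] with ε hε
      exact pow_ne_zero 2 (ne_of_gt hε)
    exact isLittleO_irrefl hfr h3
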